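/- Fix P > 0 and s > 0. For n ≥ 3 define the normalization constant F_n = ∫_{−1}^{1} (1−u²)^{(n−3)/2}·exp(n·√(Ps)·u) du and the probability density f_n(u) = (1/F_n)·(1−u²)^{(n−3)/2}·exp(n·√(Ps)·u) for u ∈ [−1,1]. Then limsup_{n→∞} (1/√n)·sup_{u∈[−1,1]} f_n(u) ≤ L(P,s). -/

import Mathlib

open MeasureTheory Real Filter
open scoped ENNReal

noncomputable section

/-- The constant `L(P,s)` from the paper. -/
def L (P s : ℝ) : ℝ :=
  (2 * P * s) ^ 2 / Real.sqrt (2 * π) *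
    Real.sqrt ((1 + 4 * P * s - Real.sqrt (1 + 4 * P * s)) /
      (Real.sqrt (1 + 4 * P * s) - 1) ^ 5)

/-- Normalization constant `F_n = ∫_{-1}^1 (1-u²)^{(n-3)/2} exp(n √(Ps) u) du`. -/
def Fnorm (P s : ℝ) (n : ℕ) : ℝ :=
  ∫ u in Set.Icc (-1 : ℝ) 1,
    (1 - u ^ 2) ^ (((n : ℝ) - 3) / 2) * Real.exp (n * Real.sqrt (P * s) * u)

/-- The probability density `f_n(u) = F_n⁻¹ (1-u²)^{(n-3)/2} exp(n √(Ps) u)` on `[-1,1]`. -/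
def fdens (P s : ℝ) (n : ℕ) (u : ℝ) : ℝ :=
  (1 / Fnorm P s n) * (1 - u ^ 2) ^ (((n : ℝ) - 3) / 2) * Real.exp (n * Real.sqrt (P * s) * u)

/-- Uniform second-order lower bound for `log (1 - 2av - bv²)` near `v = 0`, exponentiated. -/
lemma exists_exp_le_one_sub_mul_exp (A B ε : ℝ) (hA : 0 < A) (hB : 0 < B) (hε : 0 < ε) :
    ∃ δ > 0, ∀ a b v : ℝ, 0 ≤ a → a ≤ A → 0 ≤ b → b ≤ B → |v| ≤ δ →
      0 < 1 - 2 * a * v - b * v ^ 2 ∧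
      Real.exp (-(b + 2 * a ^ 2 + ε) * v ^ 2) ≤
        (1 - 2 * a * v - b * v ^ 2) * Real.exp (2 * a * v) := by
  set D := 2 * A + B with hD
  set E := 2 * A * B + B ^ 2 / 2 + 2 * D ^ 3 with hE
  have hDpos : 0 < D := by positivity
  have hEpos : 0 < E := by positivity
  refine ⟨min 1 (min (1 / (2 * D)) (ε / E)), by positivity, fun a b v ha haA hb hbB hv => ?_⟩
  obtain ⟨hv1, hv2, hv3⟩ : |v| ≤ 1 ∧ |v| ≤ 1 / (2 * D) ∧ |v| ≤ ε / E := by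
    simpa only [le_min_iff] using hv
  rw [le_div_iff₀ (by positivity)] at hv2 hv3
  have hv0 := abs_nonneg v
  have hvsq : v ^ 2 = |v| ^ 2 := (sq_abs v).symm
  obtain ⟨x, hx⟩ : ∃ x, x = 2 * a * v + b * v ^ 2 := ⟨_, rfl⟩
  have hxD : |x| ≤ D * |v| := by
    have h1 : |x| ≤ 2 * a * |v| + b * |v| ^ 2 := by
      rw [hx]
      refine (abs_add_le _ _).trans (le_of_eq ?_)
      rw [abs_mul, abs_mul b, abs_pow, abs_of_nonneg hb, abs_of_nonneg (by positivity : 0 ≤ 2 * a)]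
    have h2 : b * |v| ^ 2 ≤ B * |v| := by
      have : |v| ^ 2 ≤ |v| := by nlinarith
      gcongr
    have h3 : 2 * a * |v| ≤ 2 * A * |v| := by gcongr
    rw [hD]; linarith
  have hx2 : |x| ≤ 1 / 2 := by linarith
  have hxpos : 0 < 1 - x := by linarith [le_abs_self x]
  have hcube : |x| ^ 3 ≤ D ^ 3 * |v| ^ 3 := by
    rw [← mul_pow]; gcongr
  have hlog : -x - x ^ 2 / 2 - 2 * |x| ^ 3 ≤ Real.log (1 - x) := by
    have h := Real.abs_log_sub_add_sum_range_le (show |x| < 1 by linarith) 2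
    have h' : |x| ^ (2 + 1) / (1 - |x|) ≤ 2 * |x| ^ 3 := by
      rw [div_le_iff₀ (by linarith)]
      have : 0 ≤ |x| ^ 3 := by positivity
      norm_num
      nlinarith
    have h2 := (abs_le.1 (h.trans h')).1
    norm_num [Finset.sum_range_succ] at h2
    linarith
  have hsq : x ^ 2 / 2 ≤ 2 * a ^ 2 * v ^ 2 + (2 * A * B + B ^ 2 / 2) * |v| ^ 3 := by
    have h1 : x ^ 2 / 2 = 2 * a ^ 2 * v ^ 2 + 2 * (a * b) * v ^ 3 + b ^ 2 / 2 * |v| ^ 4 := by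
      rw [show |v| ^ 4 = (|v| ^ 2) ^ 2 by ring, ← hvsq, hx]; ring
    have h2 : 2 * (a * b) * v ^ 3 ≤ 2 * (A * B) * |v| ^ 3 := by
      have : v ^ 3 ≤ |v| ^ 3 := by rw [← abs_pow]; exact le_abs_self _
      calc 2 * (a * b) * v ^ 3 ≤ 2 * (a * b) * |v| ^ 3 := by gcongr
        _ ≤ 2 * (A * B) * |v| ^ 3 := by gcongr
    have h3 : b ^ 2 / 2 * |v| ^ 4 ≤ B ^ 2 / 2 * |v| ^ 3 := by
      have : |v| ^ 4 ≤ |v| ^ 3 := pow_le_pow_of_le_one hv0 hv1 (by norm_num)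
      gcongr
    linarith
  have hE' : E * |v| ^ 3 ≤ ε * v ^ 2 := by
    rw [hvsq]
    nlinarith [mul_le_mul_of_nonneg_right hv3 (sq_nonneg |v|)]
  have heq : 1 - 2 * a * v - b * v ^ 2 = 1 - x := by rw [hx]; ring
  rw [heq]
  refine ⟨hxpos, ?_⟩
  rw [← Real.exp_log hxpos, ← Real.exp_add, Real.exp_le_exp]
  have : 2 * a * v = x - b * v ^ 2 := by rw [hx]; ring
  rw [this]
  rw [hE] at hE'
  nlinarith

/-- The maximiser `u` of `(1 - w²) exp (2aw)` on `[-1, 1]`, with `b = 1 / (1 - u²)`. -/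
lemma exists_critical_point (a : ℝ) (ha : 0 < a) :
    ∃ u : ℝ, u ^ 2 < 1 ∧ ∀ v : ℝ, 1 - (u + v) ^ 2 =
      (1 - u ^ 2) * (1 - 2 * a * v - (Real.sqrt (1 + 4 * a ^ 2) + 1) / 2 * v ^ 2) := by
  set r := Real.sqrt (1 + 4 * a ^ 2) with hr
  have hr2 : r ^ 2 = 1 + 4 * a ^ 2 := Real.sq_sqrt (by positivity)
  have hr0 : 0 ≤ r := Real.sqrt_nonneg _
  have key : 1 - ((r - 1) / (2 * a)) ^ 2 = 2 / (r + 1) := by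
    have : a ^ 2 = (r ^ 2 - 1) / 4 := by linarith
    rw [div_pow, mul_pow, this]
    have h1 : r - 1 ≠ 0 := by
      intro h
      have : r = 1 := by linarith
      rw [this] at hr2
      nlinarith
    have h2 : r ^ 2 - 1 ≠ 0 := by
      rw [hr2, add_sub_cancel_left]; positivity
    have h3 : r + 1 ≠ 0 := by positivity
    field_simp
    ring
  refine ⟨(r - 1) / (2 * a), ?_, fun v => ?_⟩
  · have : 0 < 2 / (r + 1) := by positivity
    linarith
  · have h2 : (r - 1) / (2 * a) = a * (2 / (r + 1)) := by
      have h3 : r + 1 ≠ 0 := by positivity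
      field_simp
      linarith
    have h4 : 1 - ((r - 1) / (2 * a) + v) ^ 2 =
        (1 - ((r - 1) / (2 * a)) ^ 2) - 2 * ((r - 1) / (2 * a)) * v - v ^ 2 := by ring
    rw [h4, key, h2]
    have h3 : r + 1 ≠ 0 := by positivity
    field_simp

/-- Laplace-type comparison of the maximum of `(1-w²)^(m/2) exp(maw)` with its integral. -/
lemma mul_gaussian_le_integral (a m δ κ : ℝ) (ha : 0 < a) (hm : 0 < m) (hδ : 0 < δ)
    (h : ∀ v : ℝ, |v| ≤ δ →
      0 < 1 - 2 * a * v - (Real.sqrt (1 + 4 * a ^ 2) + 1) / 2 * v ^ 2 ∧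
      Real.exp (-κ * v ^ 2) ≤
        (1 - 2 * a * v - (Real.sqrt (1 + 4 * a ^ 2) + 1) / 2 * v ^ 2) * Real.exp (2 * a * v))
    (w : ℝ) (hw : w ∈ Set.Icc (-1 : ℝ) 1) :
    (1 - w ^ 2) ^ (m / 2) * Real.exp (m * a * w) *
        ∫ t in (-(δ * Real.sqrt m))..(δ * Real.sqrt m), Real.exp (-(κ / 2) * t ^ 2) ≤
      Real.sqrt m * ∫ u in Set.Icc (-1 : ℝ) 1, (1 - u ^ 2) ^ (m / 2) * Real.exp (m * a * u) := by
  obtain ⟨u, hu1, hu⟩ := exists_critical_point a ha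
  have hu1' : 0 < 1 - u ^ 2 := by linarith
  set g : ℝ → ℝ := fun w => (1 - w ^ 2) ^ (m / 2) * Real.exp (m * a * w) with hg
  set M := (1 - u ^ 2) * Real.exp (2 * a * u) with hM
  have hMpos : 0 < M := by positivity
  have hgp : ∀ w : ℝ, 0 ≤ 1 - w ^ 2 → g w = ((1 - w ^ 2) * Real.exp (2 * a * w)) ^ (m / 2) := by
    intro w hw
    rw [Real.mul_rpow hw (Real.exp_nonneg _), ← Real.exp_mul, hg]
    ring_nf
  have hgc : Continuous g := by
    have : Continuous fun w : ℝ => (1 - w ^ 2) ^ (m / 2) :=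
      (by fun_prop : Continuous fun w : ℝ => 1 - w ^ 2).rpow_const fun _ => Or.inr (by positivity)
    fun_prop
  have hupper : g w ≤ M ^ (m / 2) := by
    have hw0 : 0 ≤ 1 - w ^ 2 := by nlinarith [hw.1, hw.2]
    rw [hgp w hw0]
    refine Real.rpow_le_rpow (by positivity) ?_ (by positivity)
    have hv := hu (w - u)
    rw [show u + (w - u) = w by ring] at hv
    have hle : 1 - 2 * a * (w - u) - (Real.sqrt (1 + 4 * a ^ 2) + 1) / 2 * (w - u) ^ 2 ≤
        Real.exp (-(2 * a * (w - u))) := by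
      have := Real.add_one_le_exp (-(2 * a * (w - u)))
      have h2 : 0 ≤ (Real.sqrt (1 + 4 * a ^ 2) + 1) / 2 * (w - u) ^ 2 := by positivity
      linarith
    calc (1 - w ^ 2) * Real.exp (2 * a * w)
        ≤ (1 - u ^ 2) * Real.exp (-(2 * a * (w - u))) * Real.exp (2 * a * w) := by
          rw [hv]; gcongr
      _ = M := by
          rw [mul_assoc, ← Real.exp_add, hM]; ring_nf
  have hlower : ∀ v : ℝ, |v| ≤ δ → 0 < 1 - (v + u) ^ 2 ∧
      M ^ (m / 2) * Real.exp (-(κ / 2) * (Real.sqrt m * v) ^ 2) ≤ g (v + u) := by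
    intro v hv
    obtain ⟨h1, h2⟩ := h v hv
    have h3 : 0 < 1 - (v + u) ^ 2 := by rw [add_comm v u, hu v]; positivity
    refine ⟨h3, ?_⟩
    rw [hgp _ h3.le, mul_pow, Real.sq_sqrt hm.le,
      show -(κ / 2) * (m * v ^ 2) = (-κ * v ^ 2) * (m / 2) by ring, Real.exp_mul,
      ← Real.mul_rpow hMpos.le (Real.exp_nonneg _)]
    refine Real.rpow_le_rpow (by positivity) ?_ (by positivity)
    calc M * Real.exp (-κ * v ^ 2)
        ≤ M * ((1 - 2 * a * v - (Real.sqrt (1 + 4 * a ^ 2) + 1) / 2 * v ^ 2) *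
            Real.exp (2 * a * v)) := by gcongr
      _ = (1 - (v + u) ^ 2) * Real.exp (2 * a * (v + u)) := by
          rw [add_comm v u, hu v, hM, mul_add, Real.exp_add]; ring
  have hsub : Set.Ioc (-δ + u) (δ + u) ⊆ Set.Icc (-1 : ℝ) 1 := by
    intro x hx
    have := (hlower (x - u) (abs_le.2 ⟨by linarith [hx.1], by linarith [hx.2]⟩)).1
    rw [sub_add_cancel] at this
    exact abs_le.1 (abs_le_one_iff_mul_self_le_one.2 (by nlinarith))
  have hint : ∫ x in (-δ + u)..(δ + u), g x ≤ ∫ x in Set.Icc (-1 : ℝ) 1, g x := by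
    rw [intervalIntegral.integral_of_le (by linarith)]
    refine setIntegral_mono_set (hgc.continuousOn.integrableOn_compact isCompact_Icc) ?_
      (Filter.Eventually.of_forall hsub)
    refine (ae_restrict_iff' measurableSet_Icc).2 (Filter.Eventually.of_forall fun x hx => ?_)
    have hx0 : 0 ≤ 1 - x ^ 2 := by nlinarith [hx.1, hx.2]
    simp only [hg, Pi.zero_apply]
    positivity
  have hshift : ∫ v in (-δ)..δ, g (v + u) = ∫ x in (-δ + u)..(δ + u), g x :=
    intervalIntegral.integral_comp_add_right g u
  have hmono : ∫ v in (-δ)..δ, M ^ (m / 2) * Real.exp (-(κ / 2) * (Real.sqrt m * v) ^ 2) ≤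
      ∫ v in (-δ)..δ, g (v + u) := by
    refine intervalIntegral.integral_mono_on (by linarith)
      (Continuous.intervalIntegrable (by fun_prop) _ _)
      (Continuous.intervalIntegrable (by fun_prop) _ _) fun v hv => ?_
    exact (hlower v (abs_le.2 ⟨hv.1, hv.2⟩)).2
  have hscale : Real.sqrt m * ∫ v in (-δ)..δ, Real.exp (-(κ / 2) * (Real.sqrt m * v) ^ 2) =
      ∫ t in (-(δ * Real.sqrt m))..(δ * Real.sqrt m), Real.exp (-(κ / 2) * t ^ 2) := by
    have := intervalIntegral.mul_integral_comp_mul_left (a := -δ) (b := δ)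
      (f := fun t => Real.exp (-(κ / 2) * t ^ 2)) (c := Real.sqrt m)
    rw [this]
    ring_nf
  rw [intervalIntegral.integral_const_mul, hshift] at hmono
  rw [← hscale]
  have hI : 0 ≤ ∫ v in (-δ)..δ, Real.exp (-(κ / 2) * (Real.sqrt m * v) ^ 2) :=
    intervalIntegral.integral_nonneg (by linarith) fun _ _ => (Real.exp_nonneg _)
  change g w * _ ≤ Real.sqrt m * ∫ x in Set.Icc (-1 : ℝ) 1, g x
  calc g w * (Real.sqrt m * ∫ v in (-δ)..δ, Real.exp (-(κ / 2) * (Real.sqrt m * v) ^ 2))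
      ≤ M ^ (m / 2) * (Real.sqrt m * ∫ v in (-δ)..δ, Real.exp (-(κ / 2) * (Real.sqrt m * v) ^ 2)) := by
        gcongr
    _ = Real.sqrt m * (M ^ (m / 2) * ∫ v in (-δ)..δ, Real.exp (-(κ / 2) * (Real.sqrt m * v) ^ 2)) := by
        ring
    _ ≤ _ := by
        gcongr
        exact hmono.trans hint

lemma L_pos_and_curvature_lt (P s : ℝ) (h : 0 < P * s) :
    0 < L P s ∧ (Real.sqrt (1 + 4 * Real.sqrt (P * s) ^ 2) + 1) / 2 + 2 * Real.sqrt (P * s) ^ 2 <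
      2 * π * L P s ^ 2 := by
  rw [Real.sq_sqrt h.le, ← mul_assoc, L]
  set r := Real.sqrt (1 + 4 * P * s) with hr
  have hr2 : r ^ 2 = 1 + 4 * P * s := Real.sq_sqrt (by linarith)
  have hr0 : 0 ≤ r := Real.sqrt_nonneg _
  have hr1 : 1 < r := by nlinarith
  have hq : (1 + 4 * P * s - r) / (r - 1) ^ 5 = r / (r - 1) ^ 4 := by
    rw [← hr2]
    have : r - 1 ≠ 0 := by linarith
    field_simp
  have hq0 : 0 < r / (r - 1) ^ 4 := by
    have : 0 < r - 1 := by linarith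
    positivity
  rw [hq]
  have hPs : 2 * P * s = (r ^ 2 - 1) / 2 := by linarith
  have hPs0 : 0 < 2 * P * s := by linarith
  refine ⟨by positivity, ?_⟩
  have h2 : 2 * π * ((2 * P * s) ^ 2 / Real.sqrt (2 * π) * Real.sqrt (r / (r - 1) ^ 4)) ^ 2 =
      r * ((r + 1) / 2) ^ 4 := by
    rw [mul_pow, div_pow, Real.sq_sqrt hq0.le, Real.sq_sqrt (by positivity), hPs]
    have : r - 1 ≠ 0 := by linarith
    have hpi : π ≠ 0 := Real.pi_ne_zero
    rw [show r ^ 2 - 1 = (r - 1) * (r + 1) by ring]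
    field_simp
  rw [h2, show 2 * (P * s) = (r ^ 2 - 1) / 2 by linarith]
  obtain ⟨y, hy⟩ : ∃ y, y = (r + 1) / 2 := ⟨_, rfl⟩
  have hy1 : 1 < y := by linarith
  have h3 : (r + 1) / 2 + (r ^ 2 - 1) / 2 = r * y := by rw [hy]; ring
  rw [h3, ← hy]
  have : y < y ^ 4 := by
    have := pow_lt_pow_right₀ hy1 (show 1 < 4 by norm_num)
    simpa using this
  gcongr

lemma tendsto_gaussian_window (δ κ : ℝ) (hδ : 0 < δ) (hκ : 0 < κ) :
    Filter.Tendsto (fun n : ℕ =>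
      ∫ t in (-(δ * Real.sqrt ((n : ℝ) - 3)))..(δ * Real.sqrt ((n : ℝ) - 3)),
        Real.exp (-(κ / 2) * t ^ 2)) Filter.atTop (nhds (Real.sqrt (π / (κ / 2)))) := by
  have h1 : Filter.Tendsto (fun n : ℕ => δ * Real.sqrt ((n : ℝ) - 3)) Filter.atTop Filter.atTop :=
    (Real.tendsto_sqrt_atTop.comp
      (tendsto_atTop_add_const_right _ (-3) tendsto_natCast_atTop_atTop)).const_mul_atTop hδ
  rw [← integral_gaussian (κ / 2)]
  exact intervalIntegral_tendsto_integral (integrable_exp_neg_mul_sq (by positivity))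
    (tendsto_neg_atTop_atBot.comp h1) h1

/-- Lemma 1 of the paper: the sup of the density `f_n` grows at most like `L(P,s) √n`. -/
theorem limsup_sup_density_le (P s : ℝ) (hP : 0 < P) (hs : 0 < s) :
    Filter.limsup (fun n : ℕ =>
        (1 / Real.sqrt n) * sSup ((fun u => fdens P s n u) '' Set.Icc (-1 : ℝ) 1))
      Filter.atTop ≤ L P s := by
  have hPs : 0 < P * s := by positivity
  obtain ⟨hL, hcurv⟩ := L_pos_and_curvature_lt P s hPs
  set a := Real.sqrt (P * s) with ha_def
  have ha : 0 < a := Real.sqrt_pos.2 hPs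
  set curv : ℝ → ℝ := fun x => (Real.sqrt (1 + 4 * x ^ 2) + 1) / 2 + 2 * x ^ 2 with hcurv_def
  obtain ⟨κ, hκ1, hκ2⟩ := exists_between hcurv
  have hκ1 : curv a < κ := hκ1
  have hκ : 0 < κ := lt_of_le_of_lt (by simp only [hcurv_def]; positivity) hκ1
  set ε := (κ - curv a) / 2 with hε_def
  have hε : 0 < ε := by linarith
  obtain ⟨δ, hδ, hbound⟩ := exists_exp_le_one_sub_mul_exp (2 * a) κ ε (by positivity) hκ hε
  set J : ℕ → ℝ := fun n =>
    ∫ t in (-(δ * Real.sqrt ((n : ℝ) - 3)))..(δ * Real.sqrt ((n : ℝ) - 3)),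
      Real.exp (-(κ / 2) * t ^ 2) with hJ
  have hJlim : ∀ᶠ n in Filter.atTop, 1 / L P s < J n := by
    refine (tendsto_gaussian_window δ κ hδ hκ).eventually_const_lt ?_
    refine Real.lt_sqrt_of_sq_lt ?_
    rw [div_pow, one_pow, div_lt_div_iff₀ (by positivity) (by positivity)]
    linarith
  have hseq : Filter.Tendsto (fun n : ℕ => (n : ℝ) * a / ((n : ℝ) - 3)) Filter.atTop (nhds a) := by
    have h1 : Filter.Tendsto (fun n : ℕ => a + 3 * a / ((n : ℝ) - 3)) Filter.atTop
        (nhds (a + 0)) :=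
      tendsto_const_nhds.add (tendsto_const_nhds.div_atTop
        (tendsto_atTop_add_const_right _ (-3) tendsto_natCast_atTop_atTop))
    rw [add_zero] at h1
    refine h1.congr' ?_
    filter_upwards [Filter.eventually_gt_atTop 3] with n hn
    have : (3 : ℝ) < n := by exact_mod_cast hn
    have : (n : ℝ) - 3 ≠ 0 := by linarith
    field_simp
    ring
  have hcont : Continuous curv := by fun_prop
  have hcurv_ev : ∀ᶠ n : ℕ in Filter.atTop, curv ((n : ℝ) * a / ((n : ℝ) - 3)) < κ - ε :=
    ((hcont.tendsto a).comp hseq).eventually_lt_const (by linarith)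
  have hle_ev : ∀ᶠ n : ℕ in Filter.atTop, (n : ℝ) * a / ((n : ℝ) - 3) < 2 * a :=
    hseq.eventually_lt_const (by linarith)
  have hmain : ∀ᶠ n : ℕ in Filter.atTop,
      (1 / Real.sqrt n) * sSup ((fun u => fdens P s n u) '' Set.Icc (-1 : ℝ) 1) ≤ L P s := by
    filter_upwards [Filter.eventually_gt_atTop 3, hJlim, hcurv_ev, hle_ev] with n hn hJn hcn hln
    have hn3 : (3 : ℝ) < n := by exact_mod_cast hn
    set m : ℝ := (n : ℝ) - 3 with hm_def
    have hm : 0 < m := by linarith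
    set a' := (n : ℝ) * a / m with ha'_def
    have ha' : 0 < a' := by positivity
    have hma : m * a' = n * a := by rw [ha'_def]; field_simp
    simp only [hcurv_def] at hcn
    have hcmp := mul_gaussian_le_integral a' m δ κ ha' hm hδ (fun v hv => by
      obtain ⟨h1, h2⟩ := hbound a' ((Real.sqrt (1 + 4 * a' ^ 2) + 1) / 2) v ha'.le hln.le
        (by positivity) (by nlinarith [sq_nonneg a']) hv
      refine ⟨h1, le_trans (Real.exp_le_exp.2 ?_) h2⟩
      have : (Real.sqrt (1 + 4 * a' ^ 2) + 1) / 2 + 2 * a' ^ 2 + ε ≤ κ := by linarith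
      nlinarith [sq_nonneg v])
    rw [hma] at hcmp
    change ∀ w ∈ Set.Icc (-1 : ℝ) 1, _ * J n ≤ Real.sqrt m * Fnorm P s n at hcmp
    have hJpos : 0 < J n := lt_trans (by positivity) hJn
    have hF : 0 < Fnorm P s n := by
      have h0 := hcmp 0 (by norm_num)
      norm_num at h0
      exact pos_of_mul_pos_right (hJpos.trans_le h0) (Real.sqrt_nonneg _)
    have hsn : 0 < Real.sqrt n := Real.sqrt_pos.2 (by linarith)
    have hsm : Real.sqrt m ≤ Real.sqrt n := Real.sqrt_le_sqrt (by linarith)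
    have hsup : sSup ((fun u => fdens P s n u) '' Set.Icc (-1 : ℝ) 1) ≤ L P s * Real.sqrt n := by
      refine csSup_le ((Set.nonempty_Icc.2 (by norm_num)).image _) ?_
      rintro _ ⟨w, hw, rfl⟩
      have h := hcmp w hw
      have hw0 : 0 ≤ 1 - w ^ 2 := by nlinarith [hw.1, hw.2]
      rw [div_lt_iff₀ hL] at hJn
      simp only [fdens]
      rw [mul_assoc, one_div, inv_mul_le_iff₀ hF]
      set G := (1 - w ^ 2) ^ (m / 2) * Real.exp (n * a * w) with hG
      have hG0 : 0 ≤ G := by positivity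
      calc G ≤ G * (J n * L P s) := le_mul_of_one_le_right hG0 hJn.le
        _ = (G * J n) * L P s := by ring
        _ ≤ (Real.sqrt m * Fnorm P s n) * L P s := by gcongr
        _ ≤ (Real.sqrt n * Fnorm P s n) * L P s := by gcongr
        _ = _ := by ring
    rw [one_div, inv_mul_le_iff₀ hsn]
    linarith
  have hnonneg : ∀ n : ℕ,
      0 ≤ (1 / Real.sqrt n) * sSup ((fun u => fdens P s n u) '' Set.Icc (-1 : ℝ) 1) := by
    intro n
    have hg : ∀ u ∈ Set.Icc (-1 : ℝ) 1, 0 ≤ (1 - u ^ 2) ^ (((n : ℝ) - 3) / 2) *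
        Real.exp (n * Real.sqrt (P * s) * u) := by
      intro u hu
      have : 0 ≤ 1 - u ^ 2 := by nlinarith [hu.1, hu.2]
      positivity
    have hF : 0 ≤ Fnorm P s n := setIntegral_nonneg measurableSet_Icc hg
    refine mul_nonneg (by positivity) (Real.sSup_nonneg ?_)
    rintro _ ⟨w, hw, rfl⟩
    simp only [fdens]
    rw [mul_assoc]
    exact mul_nonneg (by positivity) (hg w hw)
  refine Filter.limsup_le_of_le ?_ hmain
  exact Filter.isCoboundedUnder_le_of_le Filter.atTop hnonneg

end
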